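/- Let (N,M₀) be a safe Petri net and U its unfolding with folding map f. If two conditions b,b' of U are concurrent, then f(b)≠f(b'); and if two events e,e' of U are concurrent, then f(e)≠f(e'). -/

import Mathlib

/-- A net `N = (P,T,F)`: the flow relation is split into its
place-to-transition part `pt` and transition-to-place part `tp`. -/
structure Net (P T : Type) where
  pt : P → T → Prop
  tp : T → P → Prop

namespace Net

variable {P T : Type} (N : Net P T)

/-- Preset of a transition: `•t`. -/
def preT (t : T) : Set P := {p | N.pt p t}
/-- Postset of a transition: `t•`. -/
def postT (t : T) : Set P := {p | N.tp t p}
/-- Preset of a place: `•p`. -/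
def preP (p : P) : Set T := {t | N.tp t p}
/-- Postset of a place: `p•`. -/
def postP (p : P) : Set T := {t | N.pt p t}

/-- Transition `t` is enabled at marking `M` iff `•t ⊆ M`. -/
def enabled (M : Set P) (t : T) : Prop := N.preT t ⊆ M
/-- Firing `t` at `M` yields `(M \ •t) ∪ t•`. -/
def fire (M : Set P) (t : T) : Set P := (M \ N.preT t) ∪ N.postT t
/-- One firing step between markings. -/
def stepRel (M M' : Set P) : Prop := ∃ t : T, N.enabled M t ∧ M' = N.fire M t
/-- Reachability between markings (finite firing sequences). -/
def reach (M M' : Set P) : Prop := Relation.ReflTransGen N.stepRel M M'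

/-- `(N, M₀)` is safe. -/
def safe (M₀ : Set P) : Prop :=
  ∀ M : Set P, N.reach M₀ M → ∀ t : T, N.enabled M t → M ∩ N.postT t ⊆ N.preT t

/-- `FiringSeq M l M'`: the sequence `l` of transitions can fire from `M`, ending in `M'`. -/
inductive FiringSeq : Set P → List T → Set P → Prop
  | nil (M : Set P) : FiringSeq M [] M
  | cons {M : Set P} (t : T) {l : List T} {M' : Set P} :
      N.enabled M t → FiringSeq (N.fire M t) l M' → FiringSeq M (t :: l) M'

/-- The underlying edge relation of the flow, on nodes `P ⊕ T`. -/
def edge : (P ⊕ T) → (P ⊕ T) → Prop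
  | Sum.inl p, Sum.inr t => N.pt p t
  | Sum.inr t, Sum.inl p => N.tp t p
  | _, _ => False

/-- Causality: `x < y` via a nonempty directed path. -/
def ltN (x y : P ⊕ T) : Prop := Relation.TransGen N.edge x y
/-- `x ≤ y` iff `x < y` or `x = y`. -/
def leN (x y : P ⊕ T) : Prop := N.ltN x y ∨ x = y

/-- Direct conflict of transitions: `•u ∩ •v ≠ ∅`. -/
def dirConflict (u v : T) : Prop := (N.preT u ∩ N.preT v).Nonempty
/-- Conflict of nodes `x # y`. -/
def conflict (x y : P ⊕ T) : Prop :=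
  ∃ u v : T, u ≠ v ∧ N.leN (Sum.inr u) x ∧ N.leN (Sum.inr v) y ∧ N.dirConflict u v
/-- Concurrency of nodes. -/
def concurrent (x y : P ⊕ T) : Prop :=
  ¬ N.leN x y ∧ ¬ N.leN y x ∧ ¬ N.conflict x y
/-- A co-set: a set of pairwise concurrent places (conditions). -/
def coset (S : Set P) : Prop :=
  ∀ b ∈ S, ∀ b' ∈ S, b ≠ b' → N.concurrent (Sum.inl b) (Sum.inl b')

end Net

/-- An occurrence net `O = (B, E, F, c₀)`: conditions `B`, events `E`. -/
structure OccNet (B E : Type) extends Net B E where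
  c₀ : Set B
  lt_irrefl : ∀ x : B ⊕ E, ¬ toNet.ltN x x
  pre_subsingleton : ∀ b : B, (toNet.preP b).Subsingleton
  mem_c₀_iff : ∀ b : B, b ∈ c₀ ↔ toNet.preP b = ∅
  no_self_conflict : ∀ e : E, ¬ toNet.conflict (Sum.inr e) (Sum.inr e)
  finite_past : ∀ e : E, {x : B ⊕ E | toNet.leN x (Sum.inr e)}.Finite

namespace OccNet

variable {B E : Type} (O : OccNet B E)

/-- A configuration: a causally closed, conflict-free set of events. -/
def config (C : Set E) : Prop :=
  (∀ e ∈ C, ∀ e' : E, O.toNet.ltN (Sum.inr e') (Sum.inr e) → e' ∈ C) ∧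
  (∀ e ∈ C, ∀ e' ∈ C, ¬ O.toNet.conflict (Sum.inr e) (Sum.inr e'))

/-- A run: a `⊆`-maximal configuration. -/
def run (ω : Set E) : Prop :=
  O.config ω ∧ ∀ C : Set E, O.config C → ω ⊆ C → C = ω

/-- `cut C = (c₀ ∪ C•) \ •C`. -/
def cut (C : Set E) : Set B :=
  (O.c₀ ∪ {b | ∃ e ∈ C, O.toNet.tp e b}) \ {b | ∃ e ∈ C, O.toNet.pt b e}

/-- Event `e` is enabled by configuration `C`. -/
def enabledBy (C : Set E) (e : E) : Prop := e ∉ C ∧ O.config (C ∪ {e})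

/-- `crest C`: the `<`-maximal events of `C`. -/
def crest (C : Set E) : Set E :=
  {e | e ∈ C ∧ ¬ ∃ e' ∈ C, O.toNet.ltN (Sum.inr e) (Sum.inr e')}

/-- The stump `⌊e⌋ = {e' : e' < e}` of an event. -/
def stump (e : E) : Set E := {e' | O.toNet.ltN (Sum.inr e') (Sum.inr e)}

/-- `spoiler e e'`: `e'` is a spoiler of `e`, i.e. `•e' ∩ •e ≠ ∅`. -/
def spoiler (e e' : E) : Prop := (O.toNet.preT e' ∩ O.toNet.preT e).Nonempty

/-- An event is unchallenged iff no other event shares a precondition with it. -/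
def unchallenged (e : E) : Prop :=
  ¬ ∃ e' : E, e' ≠ e ∧ (O.toNet.preT e' ∩ O.toNet.preT e).Nonempty

/-- A configuration is shaved iff its crest contains no unchallenged event. -/
def shaved (C : Set E) : Prop := ∀ e ∈ O.crest C, ¬ O.unchallenged e

/-- Strict `C`-conflict `e #^C e'`: `e ≠ e'`, `•e ∩ •e' ≠ ∅`, and `⌊e'⌋ ⊆ C`. -/
def strictConflict (C : Set E) (e e' : E) : Prop :=
  e ≠ e' ∧ (O.toNet.preT e ∩ O.toNet.preT e').Nonempty ∧ O.stump e' ⊆ C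

/-- Decisional height `δ(C)`: the number of events of `C` in strict `C`-conflict
with some event. -/
noncomputable def dHeight (C : Set E) : ℕ :=
  {e | e ∈ C ∧ ∃ e' : E, O.strictConflict C e e'}.ncard

end OccNet

/-- The unfolding `U = U(N, M₀)` of a Petri net `(N, M₀)`: an occurrence net with
conditions `B` and events `E`, together with the folding map (`fB` on conditions,
`fE` on events), satisfying the defining properties of the inductive construction:
the initial cut corresponds bijectively to `M₀`; the preset of an event `e` is a
co-set folded bijectively onto `•f(e)` and its postset is folded bijectively onto
`f(e)•`; events are uniquely determined by (preset, label) and exist for every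
co-set folding onto some `•t`; conditions are uniquely determined by
(producing event, label). -/
structure Unfolding (P T : Type) (N : Net P T) (M₀ : Set P) (B E : Type) where
  occ : OccNet B E
  fB : B → P
  fE : E → T
  init_bij : Set.BijOn fB occ.c₀ M₀
  pre_coset : ∀ e : E, occ.toNet.coset (occ.toNet.preT e)
  pre_bij : ∀ e : E, Set.BijOn fB (occ.toNet.preT e) (N.preT (fE e))
  post_bij : ∀ e : E, Set.BijOn fB (occ.toNet.postT e) (N.postT (fE e))
  event_unique : ∀ e e' : E,
    occ.toNet.preT e = occ.toNet.preT e' → fE e = fE e' → e = e'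
  event_exists : ∀ (S : Set B) (t : T), occ.toNet.coset S → Set.BijOn fB S (N.preT t) →
    ∃ e : E, occ.toNet.preT e = S ∧ fE e = t
  cond_unique : ∀ b b' : B,
    occ.toNet.preP b = occ.toNet.preP b' → fB b = fB b' → b = b'

/-- `Bad` is reachability-closed: `M ∈ Bad` and `M → M'` imply `M' ∈ Bad`. -/
def ReachClosed {P T : Type} (N : Net P T) (Bad : Set (Set P)) : Prop :=
  ∀ M ∈ Bad, ∀ M' : Set P, N.reach M M' → M' ∈ Bad

namespace Unfolding

variable {P T B E : Type} {N : Net P T} {M₀ : Set P} (U : Unfolding P T N M₀ B E)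

/-- `Mark C = f(cut C)`. -/
def Mark (C : Set E) : Set P := U.fB '' U.occ.cut C

/-- A finite configuration is doomed iff every run extending it contains a finite
configuration (extending it) whose marking is bad. -/
def doomed (Bad : Set (Set P)) (C : Set E) : Prop :=
  ∀ ω : Set E, U.occ.run ω → C ⊆ ω →
    ∃ C' : Set E, C'.Finite ∧ U.occ.config C' ∧ C ⊆ C' ∧ C' ⊆ ω ∧ U.Mark C' ∈ Bad

/-- A configuration is free iff it is not doomed. -/
def free (Bad : Set (Set P)) (C : Set E) : Prop := ¬ U.doomed Bad C

/-- A finite configuration is minimally doomed iff it is doomed and no proper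
sub-configuration of it is doomed. -/
def minDoomed (Bad : Set (Set P)) (C : Set E) : Prop :=
  C.Finite ∧ U.occ.config C ∧ U.doomed Bad C ∧
  ∀ C' : Set E, C' ⊂ C → U.occ.config C' → ¬ U.doomed Bad C'

/-- A (finite) prefix of the unfolding: a finite, causally closed set of events. -/
def isPrefix (E' : Set E) : Prop :=
  E'.Finite ∧ ∀ e ∈ E', ∀ e' : E, U.occ.toNet.ltN (Sum.inr e') (Sum.inr e) → e' ∈ E'

/-- A complete prefix `Π₀` of the unfolding. -/
def isCompletePrefix (E' : Set E) : Prop :=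
  U.isPrefix E' ∧
  ∀ M : Set P, N.reach M₀ M →
    ∃ C : Set E, U.occ.config C ∧ C ⊆ E' ∧ U.Mark C = M ∧
      ∀ t : T, N.enabled M t → ∃ e ∈ E', U.fE e = t ∧ U.occ.enabledBy C e

/-- `isPi1 E₀ E₁`: `E₀` is a complete prefix `Π₀` and `E₁` is the prefix `Π₁`
obtained by appending, after every `⊆`-maximal configuration `Cm` of `Π₀`, a
complete prefix of the unfolding of `(N, Mark Cm)`. -/
def isPi1 (E₀ E₁ : Set E) : Prop :=
  U.isCompletePrefix E₀ ∧ U.isPrefix E₁ ∧ E₀ ⊆ E₁ ∧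
  ∀ Cm : Set E, U.occ.config Cm → Cm ⊆ E₀ →
    (∀ C' : Set E, U.occ.config C' → C' ⊆ E₀ → Cm ⊆ C' → C' = Cm) →
    ∀ M : Set P, N.reach (U.Mark Cm) M →
      ∃ C : Set E, U.occ.config C ∧ Cm ⊆ C ∧ C ⊆ E₁ ∧ U.Mark C = M ∧
        ∀ t : T, N.enabled M t → ∃ e ∈ E₁, U.fE e = t ∧ U.occ.enabledBy C e

end Unfolding

namespace Net

variable {P T : Type} {N : Net P T}

/-- The last edge of a path into a place comes from a transition of its preset. -/
theorem exists_pre_of_lt_place {t : T} {p : P} (h : N.ltN (Sum.inr t) (Sum.inl p)) :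
    ∃ u, N.tp u p ∧ N.leN (Sum.inr t) (Sum.inr u) := by
  rcases Relation.TransGen.tail'_iff.1 h with ⟨x, hx, hxp⟩
  rcases x with q | u
  · exact hxp.elim
  · refine ⟨u, hxp, ?_⟩
    rcases Relation.reflTransGen_iff_eq_or_transGen.1 hx with h | h
    · exact Or.inr h.symm
    · exact Or.inl h

/-- The first edge of a path out of a place leads to a transition of its postset. -/
theorem exists_post_of_place_lt {p : P} {x : P ⊕ T} (h : N.ltN (Sum.inl p) x) :
    ∃ u, N.pt p u ∧ N.leN (Sum.inr u) x := by
  rcases Relation.TransGen.head'_iff.1 h with ⟨y, hpy, hy⟩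
  rcases y with q | u
  · exact hpy.elim
  · refine ⟨u, hpy, ?_⟩
    rcases Relation.reflTransGen_iff_eq_or_transGen.1 hy with h | h
    · exact Or.inr h.symm
    · exact Or.inl h

theorem lt_of_pt {p : P} {t : T} (h : N.pt p t) : N.ltN (Sum.inl p) (Sum.inr t) :=
  Relation.TransGen.single h

theorem lt_of_tp {p : P} {t : T} (h : N.tp t p) : N.ltN (Sum.inr t) (Sum.inl p) :=
  Relation.TransGen.single h

theorem leN.trans_lt {x y z : P ⊕ T} (h : N.leN x y) (h' : N.ltN y z) : N.ltN x z := by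
  rcases h with h | rfl
  · exact Relation.TransGen.trans h h'
  · exact h'

theorem dirConflict.symm {u v : T} (h : N.dirConflict u v) : N.dirConflict v u := by
  rwa [dirConflict, Set.inter_comm]

theorem conflict.symm {x y : P ⊕ T} (h : N.conflict x y) : N.conflict y x := by
  obtain ⟨u, v, huv, hu, hv, hd⟩ := h
  exact ⟨v, u, huv.symm, hv, hu, hd.symm⟩

theorem concurrent.symm {x y : P ⊕ T} (h : N.concurrent x y) : N.concurrent y x :=
  ⟨h.2.1, h.1, fun hc => h.2.2 hc.symm⟩

theorem lt_of_le_place {t : T} {p : P} (h : N.leN (Sum.inr t) (Sum.inl p)) :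
    N.ltN (Sum.inr t) (Sum.inl p) := by
  rcases h with h | h
  · exact h
  · cases h

/-- Conflict is inherited along causality. -/
theorem conflict.mono {x y x' y' : P ⊕ T} (h : N.conflict x y) (hx : N.ltN x x')
    (hy : N.ltN y y') : N.conflict x' y' := by
  obtain ⟨u, v, huv, hu, hv, hd⟩ := h
  exact ⟨u, v, huv, Or.inl (hu.trans_lt hx), Or.inl (hv.trans_lt hy), hd⟩

end Net

namespace OccNet

variable {B E : Type} (O : OccNet B E)

theorem not_conflict_self_condition (b : B) :
    ¬ O.toNet.conflict (Sum.inl b) (Sum.inl b) := by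
  rintro ⟨u, v, huv, hu, hv, hd⟩
  obtain ⟨e, he, hue⟩ := Net.exists_pre_of_lt_place (Net.lt_of_le_place hu)
  obtain ⟨e', he', hve⟩ := Net.exists_pre_of_lt_place (Net.lt_of_le_place hv)
  obtain rfl : e = e' := O.pre_subsingleton b he he'
  exact O.no_self_conflict e ⟨u, v, huv, hue, hve, hd⟩

theorem finite_lt_condition (b : B) :
    {e : E | O.toNet.ltN (Sum.inr e) (Sum.inl b)}.Finite := by
  by_cases h : ∃ e, O.toNet.tp e b
  · obtain ⟨e, he⟩ := h
    refine ((O.finite_past e).preimage Sum.inr_injective.injOn).subset fun g hg => ?_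
    obtain ⟨e', he', hge⟩ := Net.exists_pre_of_lt_place hg
    obtain rfl : e = e' := O.pre_subsingleton b he he'
    exact hge
  · refine Set.finite_empty.subset fun g hg => h ?_
    obtain ⟨e', he', -⟩ := Net.exists_pre_of_lt_place hg
    exact ⟨e', he'⟩

theorem mem_c₀_or_exists_pre (b : B) : b ∈ O.c₀ ∨ ∃ e, O.toNet.tp e b := by
  rw [O.mem_c₀_iff]
  exact Set.eq_empty_or_nonempty _

theorem exists_maximal_event {C : Set E} (hfin : C.Finite) (hne : C.Nonempty) :
    ∃ e ∈ C, ∀ g ∈ C, ¬ O.toNet.ltN (Sum.inr e) (Sum.inr g) := by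
  let r : E → E → Prop := fun x y => O.toNet.ltN (Sum.inr y) (Sum.inr x)
  have : IsStrictOrder E r :=
    { irrefl := fun x => O.lt_irrefl _
      trans := fun _ _ _ h h' => Relation.TransGen.trans h' h }
  have hwf : C.WellFoundedOn r := hfin.wellFoundedOn
  obtain ⟨c, hc⟩ := hne
  obtain ⟨⟨e, he⟩, -, hmin⟩ := WellFounded.has_min hwf Set.univ ⟨⟨c, hc⟩, trivial⟩
  exact ⟨e, he, fun g hg => hmin ⟨g, hg⟩ trivial⟩

/-- Removing a causally maximal event from a configuration leaves a configuration. -/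
theorem config_diff_maximal {C : Set E} (hC : O.config C) {e : E}
    (hmax : ∀ g ∈ C, ¬ O.toNet.ltN (Sum.inr e) (Sum.inr g)) : O.config (C \ {e}) := by
  refine ⟨fun g hg g' hlt => ⟨hC.1 g hg.1 g' hlt, ?_⟩, fun g hg g' hg' => hC.2 g hg.1 g' hg'.1⟩
  rintro rfl
  exact hmax g hg.1 hlt

theorem pre_subset_cut_diff {C : Set E} (hC : O.config C) {e : E} (he : e ∈ C) :
    O.toNet.preT e ⊆ O.cut (C \ {e}) := by
  intro d hd
  refine ⟨?_, ?_⟩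
  · refine (O.mem_c₀_or_exists_pre d).imp_right ?_
    rintro ⟨g, hg⟩
    have hlt : O.toNet.ltN (Sum.inr g) (Sum.inr e) :=
      Relation.TransGen.trans (Net.lt_of_tp hg) (Net.lt_of_pt hd)
    refine ⟨g, ⟨hC.1 e he g hlt, ?_⟩, hg⟩
    rintro rfl
    exact O.lt_irrefl _ hlt
  · rintro ⟨h, ⟨hh, hne⟩, hdh⟩
    exact hC.2 h hh e he ⟨h, e, hne, Or.inr rfl, Or.inr rfl, d, hdh, hd⟩

theorem cut_eq_of_maximal {C : Set E} {e : E} (he : e ∈ C)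
    (hmax : ∀ g ∈ C, ¬ O.toNet.ltN (Sum.inr e) (Sum.inr g)) :
    O.cut C = (O.cut (C \ {e}) \ O.toNet.preT e) ∪ O.toNet.postT e := by
  ext d
  constructor
  · rintro ⟨hprod, hcons⟩
    by_cases hde : O.toNet.tp e d
    · exact Or.inr hde
    · refine Or.inl ⟨⟨hprod.imp_right ?_, ?_⟩, fun h => hcons ⟨e, he, h⟩⟩
      · rintro ⟨g, hg, hgd⟩
        exact ⟨g, ⟨hg, by rintro rfl; exact hde hgd⟩, hgd⟩
      · rintro ⟨g, hg, hgd⟩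
        exact hcons ⟨g, hg.1, hgd⟩
  · rintro (⟨⟨hprod, hcons⟩, hde⟩ | hde)
    · refine ⟨hprod.imp_right ?_, ?_⟩
      · rintro ⟨g, hg, hgd⟩
        exact ⟨g, hg.1, hgd⟩
      · rintro ⟨g, hg, hgd⟩
        by_cases hge : g = e
        · exact hde (hge ▸ hgd)
        · exact hcons ⟨g, ⟨hg, hge⟩, hgd⟩
    · refine ⟨Or.inr ⟨e, he, hde⟩, ?_⟩
      rintro ⟨g, hg, hgd⟩
      exact hmax g hg (Relation.TransGen.trans (Net.lt_of_tp hde) (Net.lt_of_pt hgd))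

/-- The events below one of two concurrent conditions form a configuration. -/
theorem config_below_pair {b b' : B}
    (h : O.toNet.concurrent (Sum.inl b) (Sum.inl b')) :
    O.config ({e | O.toNet.ltN (Sum.inr e) (Sum.inl b)} ∪
      {e | O.toNet.ltN (Sum.inr e) (Sum.inl b')}) := by
  refine ⟨fun e he g hge => he.imp (Relation.TransGen.trans hge) (Relation.TransGen.trans hge), ?_⟩
  rintro e (he | he) g (hg | hg) hc
  · exact O.not_conflict_self_condition b (hc.mono he hg)
  · exact h.2.2 (hc.mono he hg)
  · exact h.2.2 (hc.symm.mono hg he)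
  · exact O.not_conflict_self_condition b' (hc.mono he hg)

theorem mem_cut_below_pair {b b' : B}
    (h : O.toNet.concurrent (Sum.inl b) (Sum.inl b')) :
    b ∈ O.cut ({e | O.toNet.ltN (Sum.inr e) (Sum.inl b)} ∪
      {e | O.toNet.ltN (Sum.inr e) (Sum.inl b')}) := by
  refine ⟨(O.mem_c₀_or_exists_pre b).imp_right ?_, ?_⟩
  · rintro ⟨e, he⟩
    exact ⟨e, Or.inl (Net.lt_of_tp he), he⟩
  · rintro ⟨e, he | he, hbe⟩
    · exact O.lt_irrefl _ (Relation.TransGen.trans (Net.lt_of_pt hbe) he)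
    · exact h.1 (Or.inl (Relation.TransGen.trans (Net.lt_of_pt hbe) he))

/-- Distinct preconditions of two concurrent events are not causally ordered. -/
theorem not_le_of_pre_of_concurrent {e e' : E} {b b' : B}
    (h : O.toNet.concurrent (Sum.inr e) (Sum.inr e')) (hb : O.toNet.pt b e)
    (hb' : O.toNet.pt b' e') (hne : b ≠ b') :
    ¬ O.toNet.leN (Sum.inl b) (Sum.inl b') := by
  rintro (hlt | heq)
  · obtain ⟨g, hbg, hg⟩ := Net.exists_post_of_place_lt hlt
    have hge : O.toNet.ltN (Sum.inr g) (Sum.inr e') := hg.trans_lt (Net.lt_of_pt hb')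
    by_cases heg : e = g
    · exact h.1 (Or.inl (heg ▸ hge))
    · exact h.2.2 ⟨e, g, heg, Or.inr rfl, Or.inl hge, b, hb, hbg⟩
  · exact hne (Sum.inl_injective heq)

theorem concurrent_of_pre_of_concurrent {e e' : E} {b b' : B}
    (h : O.toNet.concurrent (Sum.inr e) (Sum.inr e')) (hb : O.toNet.pt b e)
    (hb' : O.toNet.pt b' e') (hne : b ≠ b') :
    O.toNet.concurrent (Sum.inl b) (Sum.inl b') :=
  ⟨O.not_le_of_pre_of_concurrent h hb hb' hne,
    O.not_le_of_pre_of_concurrent h.symm hb' hb hne.symm,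
    fun hc => h.2.2 (hc.mono (Net.lt_of_pt hb) (Net.lt_of_pt hb'))⟩

end OccNet

namespace Unfolding

variable {P T B E : Type} {N : Net P T} {M₀ : Set P} (U : Unfolding P T N M₀ B E)

theorem cut_empty : U.occ.cut ∅ = U.occ.c₀ := by
  simp [OccNet.cut]

/-- Firing the label of a maximal event of a configuration. -/
theorem Mark_eq_fire {C : Set E} (hC : U.occ.config C) {e : E} (he : e ∈ C)
    (hmax : ∀ g ∈ C, ¬ U.occ.toNet.ltN (Sum.inr e) (Sum.inr g))
    (hinj : Set.InjOn U.fB (U.occ.cut (C \ {e}))) :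
    U.Mark C = N.fire (U.Mark (C \ {e})) (U.fE e) := by
  rw [Mark, U.occ.cut_eq_of_maximal he hmax, Set.image_union,
    hinj.image_sdiff_subset (U.occ.pre_subset_cut_diff hC he), (U.pre_bij e).image_eq,
    (U.post_bij e).image_eq]
  rfl

/-- In the unfolding of a safe net, the cut of a finite configuration folds injectively
onto a reachable marking. -/
theorem reach_Mark_and_injOn_cut (hsafe : N.safe M₀) {C : Set E} (hfin : C.Finite)
    (hC : U.occ.config C) : N.reach M₀ (U.Mark C) ∧ Set.InjOn U.fB (U.occ.cut C) := by
  induction hn : C.ncard generalizing C with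
  | zero =>
    obtain rfl : C = ∅ := (Set.ncard_eq_zero hfin).1 hn
    rw [Mark, cut_empty, U.init_bij.image_eq]
    exact ⟨Relation.ReflTransGen.refl, U.init_bij.injOn⟩
  | succ n ih =>
    have hne : C.Nonempty := Set.nonempty_of_ncard_ne_zero (by omega)
    obtain ⟨e, he, hmax⟩ := U.occ.exists_maximal_event hfin hne
    obtain ⟨hreach, hinj⟩ := ih (hfin.subset Set.sdiff_subset)
      (U.occ.config_diff_maximal hC hmax)
      (by rw [Set.ncard_sdiff_singleton_of_mem he]; omega)
    have hpre := U.occ.pre_subset_cut_diff hC he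
    have hen : N.enabled (U.Mark (C \ {e})) (U.fE e) := by
      rw [Net.enabled, ← (U.pre_bij e).image_eq]
      exact Set.image_mono hpre
    refine ⟨hreach.tail ⟨U.fE e, hen, U.Mark_eq_fire hC he hmax hinj⟩, ?_⟩
    have hfresh : ∀ d ∈ U.occ.cut (C \ {e}) \ U.occ.toNet.preT e,
        ∀ d' ∈ U.occ.toNet.postT e, U.fB d ≠ U.fB d' := by
      intro d hd d' hd' heq
      have hmem : U.fB d ∈ N.preT (U.fE e) :=
        hsafe _ hreach _ hen ⟨⟨d, hd.1, rfl⟩, heq ▸ (U.post_bij e).mapsTo hd'⟩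
      obtain ⟨c, hc, hcd⟩ := (U.pre_bij e).surjOn hmem
      exact hd.2 (hinj (hpre hc) hd.1 hcd ▸ hc)
    rw [U.occ.cut_eq_of_maximal he hmax]
    rintro d (hd | hd) d' (hd' | hd') heq
    · exact hinj hd.1 hd'.1 heq
    · exact (hfresh d hd d' hd' heq).elim
    · exact (hfresh d' hd' d hd heq.symm).elim
    · exact (U.post_bij e).injOn hd hd' heq

theorem fB_ne_of_concurrent (hsafe : N.safe M₀) {b b' : B}
    (h : U.occ.toNet.concurrent (Sum.inl b) (Sum.inl b')) : U.fB b ≠ U.fB b' := by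
  intro heq
  have hinj := (U.reach_Mark_and_injOn_cut hsafe
    ((U.occ.finite_lt_condition b).union (U.occ.finite_lt_condition b'))
    (U.occ.config_below_pair h)).2
  have hb' := U.occ.mem_cut_below_pair h.symm
  rw [Set.union_comm] at hb'
  exact h.1 (Or.inr (congrArg Sum.inl (hinj (U.occ.mem_cut_below_pair h) hb' heq)))

theorem preT_subset_of_concurrent (hsafe : N.safe M₀) {e e' : E}
    (h : U.occ.toNet.concurrent (Sum.inr e) (Sum.inr e')) (heq : U.fE e = U.fE e') :
    U.occ.toNet.preT e ⊆ U.occ.toNet.preT e' := by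
  intro b hb
  obtain ⟨b', hb', hbb⟩ := (U.pre_bij e').surjOn (heq ▸ (U.pre_bij e).mapsTo hb)
  by_contra hnot
  refine U.fB_ne_of_concurrent hsafe
    (U.occ.concurrent_of_pre_of_concurrent h hb hb' ?_) hbb.symm
  rintro rfl
  exact hnot hb'

theorem fE_ne_of_concurrent (hsafe : N.safe M₀) {e e' : E}
    (h : U.occ.toNet.concurrent (Sum.inr e) (Sum.inr e')) : U.fE e ≠ U.fE e' := by
  intro heq
  exact h.1 (Or.inr (congrArg Sum.inr (U.event_unique e e'
    ((U.preT_subset_of_concurrent hsafe h heq).antisymm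
      (U.preT_subset_of_concurrent hsafe h.symm heq.symm)) heq)))

end Unfolding

/-- part of Lemma 1 of the paper: in the unfolding of a safe
Petri net, concurrent conditions fold to distinct places, and concurrent events
fold to distinct transitions. -/
theorem concurrent_fold_ne
    {P T B E : Type} [Finite P] [Finite T]
    (N : Net P T) (M₀ : Set P) (hsafe : N.safe M₀)
    (U : Unfolding P T N M₀ B E) :
    (∀ b b' : B, U.occ.toNet.concurrent (Sum.inl b) (Sum.inl b') →
      U.fB b ≠ U.fB b') ∧
    (∀ e e' : E, U.occ.toNet.concurrent (Sum.inr e) (Sum.inr e') →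
      U.fE e ≠ U.fE e') := by
  exact ⟨fun _ _ => U.fB_ne_of_concurrent hsafe, fun _ _ => U.fE_ne_of_concurrent hsafe⟩
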